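/- arXiv:2507.15475 — 6 statements merged into one kernel-verified Lean document; each statement's English description precedes it below -/
import Mathlib

section
/- For every real θ with −a ≤ θ ≤ a, the probability under the product measure μ_a ⊗ μ_a of the set {(φ₁, φ₂) ∈ ℝ² : arg(e^{iφ₁} + e^{iφ₂}) ≤ θ} equals (a² + 2aθ − sign(θ)·θ²) / (2a²), where sign(θ) is +1 for θ > 0, 0 for θ = 0, and −1 for θ < 0. -/
open MeasureTheory Real

/-- The uniform probability measure on the interval `[-a, a]`:
Lebesgue measure restricted to `[-a, a]`, normalized by `1/(2a)`. -/
noncomputable def mu (a : ℝ) : Measure ℝ :=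
  (ENNReal.ofReal (2 * a))⁻¹ • volume.restrict (Set.Icc (-a) a)

lemma arg_sum_aux (x y : ℝ) (h1 : -π < x - y) (h2 : x - y < π) (h3 : -π < (x+y)/2)
    (h4 : (x+y)/2 ≤ π) :
    Complex.arg (Complex.exp ((x : ℂ) * Complex.I) + Complex.exp ((y : ℂ) * Complex.I))
      = (x + y) / 2 := by
  have hc : 0 < Real.cos ((x - y)/2) := Real.cos_pos_of_mem_Ioo ⟨by linarith, by linarith⟩
  have key : Complex.exp ((x : ℂ) * Complex.I) + Complex.exp ((y : ℂ) * Complex.I)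
      = ((2 * Real.cos ((x - y)/2) : ℝ) : ℂ) *
        (Complex.cos (((x+y)/2 : ℝ) : ℂ) + Complex.sin (((x+y)/2 : ℝ) : ℂ) * Complex.I) := by
    rw [← Complex.exp_mul_I]
    push_cast
    rw [Complex.two_cos, add_mul, ← Complex.exp_add, ← Complex.exp_add]
    congr 2 <;> ring
  rw [key, Complex.arg_mul_cos_add_sin_mul_I (by positivity) ⟨h3, h4⟩]

lemma int_aux (a : ℝ) (ha : 0 < a) (θ : ℝ) (hθ1 : -a ≤ θ) (hθ2 : θ ≤ a) :
    ∫ x in (-a)..a, max 0 (min a (2 * θ - x) + a)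
      = 2 * (a ^ 2 + 2 * a * θ - Real.sign θ * θ ^ 2) := by
  have hI : ∀ u v : ℝ, IntervalIntegrable (fun x : ℝ => max 0 (min a (2 * θ - x) + a)) volume u v :=
    fun u v => Continuous.intervalIntegrable (by fun_prop) u v
  have hlin : ∀ u v c : ℝ, ∫ x in u..v, (c - x) = c * (v - u) - (v^2 - u^2)/2 := by
    intro u v c
    rw [intervalIntegral.integral_sub (by simp) (by simp)]
    simp [mul_comm]
  rcases le_total θ 0 with h | h
  · rw [← intervalIntegral.integral_add_adjacent_intervals (hI (-a) (2*θ+a)) (hI (2*θ+a) a)]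
    have e1 : ∫ x in (-a)..(2*θ+a), max 0 (min a (2 * θ - x) + a)
        = ∫ x in (-a)..(2*θ+a), ((2*θ+a) - x) := by
      apply intervalIntegral.integral_congr
      intro x hx
      rw [Set.uIcc_of_le (by linarith)] at hx
      obtain ⟨p, q⟩ := hx
      simp only
      rw [min_eq_right (by linarith), max_eq_right (by linarith)]; ring
    have e2 : ∫ x in (2*θ+a)..a, max 0 (min a (2 * θ - x) + a)
        = ∫ x in (2*θ+a)..a, (0:ℝ) := by
      apply intervalIntegral.integral_congr
      intro x hx
      rw [Set.uIcc_of_le (by linarith)] at hx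
      obtain ⟨p, q⟩ := hx
      simp only
      rw [min_eq_right (by linarith), max_eq_left (by linarith)]
    rw [e1, e2, hlin]
    rcases h.lt_or_eq with h | h
    · rw [Real.sign_of_neg h]; simp; ring
    · subst h; simp; ring
  · rw [← intervalIntegral.integral_add_adjacent_intervals (hI (-a) (2*θ-a)) (hI (2*θ-a) a)]
    have e1 : ∫ x in (2*θ-a)..a, max 0 (min a (2 * θ - x) + a)
        = ∫ x in (2*θ-a)..a, ((2*θ+a) - x) := by
      apply intervalIntegral.integral_congr
      intro x hx
      rw [Set.uIcc_of_le (by linarith)] at hx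
      obtain ⟨p, q⟩ := hx
      simp only
      rw [min_eq_right (by linarith), max_eq_right (by linarith)]; ring
    have e2 : ∫ x in (-a)..(2*θ-a), max 0 (min a (2 * θ - x) + a)
        = ∫ x in (-a)..(2*θ-a), (2*a:ℝ) := by
      apply intervalIntegral.integral_congr
      intro x hx
      rw [Set.uIcc_of_le (by linarith)] at hx
      obtain ⟨p, q⟩ := hx
      simp only
      rw [min_eq_left (by linarith), max_eq_right (by linarith)]; ring
    rw [e1, e2, hlin]
    rcases h.lt_or_eq with h | h
    · rw [Real.sign_of_pos h]; simp; ring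
    · subst h; simp; ring

theorem stmt2 (a : ℝ) (ha : 0 < a) (ha' : a ≤ π / 2)
    (θ : ℝ) (hθ1 : -a ≤ θ) (hθ2 : θ ≤ a) :
    ((mu a).prod (mu a)) {p : ℝ × ℝ |
        Complex.arg (Complex.exp ((p.1 : ℂ) * Complex.I) + Complex.exp ((p.2 : ℂ) * Complex.I)) ≤ θ}
      = ENNReal.ofReal ((a ^ 2 + 2 * a * θ - Real.sign θ * θ ^ 2) / (2 * a ^ 2)) := by
  have hS : MeasurableSet {p : ℝ × ℝ |
        Complex.arg (Complex.exp ((p.1 : ℂ) * Complex.I) + Complex.exp ((p.2 : ℂ) * Complex.I)) ≤ θ} := by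
    apply measurableSet_le _ measurable_const
    apply Complex.measurable_arg.comp
    fun_prop
  have hpos : 0 < 2 * a := by positivity
  have hc : (ENNReal.ofReal (2 * a))⁻¹ = ENNReal.ofReal ((2*a)⁻¹) :=
    (ENNReal.ofReal_inv_of_pos hpos).symm
  haveI : SFinite (mu a) := by unfold mu; infer_instance
  rw [Measure.prod_apply hS]
  have hin : ∀ x ∈ Set.Ioo (-a) a, (mu a) (Prod.mk x ⁻¹' {p : ℝ × ℝ |
        Complex.arg (Complex.exp ((p.1 : ℂ) * Complex.I) + Complex.exp ((p.2 : ℂ) * Complex.I)) ≤ θ})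
      = ENNReal.ofReal ((2*a)⁻¹) * ENNReal.ofReal (max 0 (min a (2 * θ - x) + a)) := by
    intro x hx
    have hm := measurable_prodMk_left (x := x) hS
    unfold mu
    rw [Measure.smul_apply, Measure.restrict_apply hm, hc, smul_eq_mul]
    congr 1
    have : (Prod.mk x ⁻¹' {p : ℝ × ℝ |
        Complex.arg (Complex.exp ((p.1 : ℂ) * Complex.I) + Complex.exp ((p.2 : ℂ) * Complex.I)) ≤ θ})
        ∩ Set.Icc (-a) a = Set.Icc (-a) (min a (2 * θ - x)) := by
      ext y
      simp only [Set.mem_inter_iff, Set.mem_preimage, Set.mem_setOf_eq, Set.mem_Icc, le_min_iff]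
      obtain ⟨p, q⟩ := hx
      constructor
      · rintro ⟨h, h1, h2⟩
        rw [arg_sum_aux x y (by linarith) (by linarith) (by linarith) (by linarith)] at h
        exact ⟨h1, h2, by linarith⟩
      · rintro ⟨h1, h2, h⟩
        rw [arg_sum_aux x y (by linarith) (by linarith) (by linarith) (by linarith)]
        exact ⟨by linarith, h1, h2⟩
    rw [this, Real.volume_Icc, sub_neg_eq_add]
    rcases le_total 0 (min a (2 * θ - x) + a) with h | h
    · rw [max_eq_right h]
    · rw [max_eq_left h, ENNReal.ofReal_of_nonpos h, ENNReal.ofReal_zero]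
  have hmu : mu a = ENNReal.ofReal ((2*a)⁻¹) • volume.restrict (Set.Ioo (-a) a) := by
    unfold mu; rw [restrict_Ioo_eq_restrict_Icc, hc]
  generalize hF : (fun x => (mu a) (Prod.mk x ⁻¹' {p : ℝ × ℝ |
        Complex.arg (Complex.exp ((p.1 : ℂ) * Complex.I) + Complex.exp ((p.2 : ℂ) * Complex.I)) ≤ θ})) = F
  have hF' : ∀ x ∈ Set.Ioo (-a) a, F x
      = ENNReal.ofReal ((2*a)⁻¹) * ENNReal.ofReal (max 0 (min a (2 * θ - x) + a)) := by
    intro x hx; rw [← hF]; exact hin x hx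
  rw [hmu, lintegral_smul_measure, setLIntegral_congr_fun measurableSet_Ioo hF',
    lintegral_const_mul _ (by fun_prop), ← ofReal_integral_eq_lintegral_ofReal,
    ← integral_Ioc_eq_integral_Ioo, ← intervalIntegral.integral_of_le (by linarith),
    int_aux a ha θ hθ1 hθ2, smul_eq_mul, ← ENNReal.ofReal_mul (by positivity),
    ← ENNReal.ofReal_mul (by positivity)]
  · congr 1
    field_simp
  · have : Continuous (fun x : ℝ => max 0 (min a (2 * θ - x) + a)) := by fun_prop
    exact (this.integrableOn_Icc (a := -a) (b := a)).mono_set Set.Ioo_subset_Icc_self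
  · exact Filter.Eventually.of_forall fun x => le_max_left _ _
end

section
/- The pushforward of the product measure μ_a ⊗ μ_a under the map (φ₁, φ₂) ↦ arg(e^{iφ₁} + e^{iφ₂}) is absolutely continuous with respect to Lebesgue measure on ℝ, with density f given by the triangular density f(θ) = (1/a)·(1 − |θ|/a) for −a ≤ θ ≤ a, and f(θ) = 0 otherwise. -/
open MeasureTheory Real

/-- The triangular density of the resulting angle after two steps. -/
noncomputable def angleDensity (a : ℝ) (θ : ℝ) : ℝ :=
  if -a ≤ θ ∧ θ ≤ a then (1 / a) * (1 - |θ| / a) else 0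

lemma arg_half (a : ℝ) (ha' : a ≤ π / 2) (x y : ℝ)
    (hx : x ∈ Set.Icc (-a) a) (hy : y ∈ Set.Icc (-a) a) :
    Complex.arg (Complex.exp ((x : ℂ) * Complex.I) + Complex.exp ((y : ℂ) * Complex.I))
      = (x + y) / 2 := by
  obtain ⟨hx1, hx2⟩ := hx
  obtain ⟨hy1, hy2⟩ := hy
  have key : Complex.exp ((x : ℂ) * Complex.I) + Complex.exp ((y : ℂ) * Complex.I)
      = ((2 * Real.cos ((x - y) / 2) : ℝ) : ℂ) *
        (Complex.cos (((x + y) / 2 : ℝ) : ℂ) + Complex.sin (((x + y) / 2 : ℝ) : ℂ) * Complex.I) := by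
    rw [← Complex.exp_mul_I]
    push_cast
    rw [Complex.two_cos, add_mul, ← Complex.exp_add, ← Complex.exp_add]
    congr 2 <;> ring
  have hpi := Real.pi_pos
  have h0 : 0 ≤ Real.cos ((x - y) / 2) :=
    Real.cos_nonneg_of_mem_Icc ⟨by linarith, by linarith⟩
  rcases h0.lt_or_eq with h | h
  · rw [key, Complex.arg_mul_cos_add_sin_mul_I (by positivity) ⟨by linarith, by linarith⟩]
  · rw [key, ← h]
    simp only [mul_zero, Complex.ofReal_zero, zero_mul, Complex.arg_zero]
    have h1 : ¬ (-(π / 2) < (x - y) / 2 ∧ (x - y) / 2 < π / 2) := fun hh =>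
      (Real.cos_pos_of_mem_Ioo ⟨hh.1, hh.2⟩).ne h
    by_cases h2 : -(π / 2) < (x - y) / 2
    · have h3 : π / 2 ≤ (x - y) / 2 := by
        by_contra h4
        exact h1 ⟨h2, not_le.mp h4⟩
      linarith
    · linarith [not_lt.mp h2]

lemma lint_sub (g : ℝ → ENNReal) (hg : Measurable g) (x : ℝ) :
    ∫⁻ y, g y = ENNReal.ofReal 2 * ∫⁻ t, g (2 * t - x) := by
  rw [← lintegral_sub_right_eq_self g x]
  conv_lhs => rw [← Real.smul_map_volume_mul_left (two_ne_zero)]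
  rw [lintegral_smul_measure, lintegral_map (by fun_prop) (by fun_prop)]
  simp

lemma vol_slice (a t : ℝ) :
    volume {x : ℝ | x ∈ Set.Icc (-a) a ∧ 2 * t - x ∈ Set.Icc (-a) a}
      = ENNReal.ofReal (2 * (a - |t|)) := by
  have : {x : ℝ | x ∈ Set.Icc (-a) a ∧ 2 * t - x ∈ Set.Icc (-a) a}
      = Set.Icc (t - (a - |t|)) (t + (a - |t|)) := by
    ext x
    simp only [Set.mem_setOf_eq, Set.mem_Icc]
    rcases abs_cases t with ⟨h, _⟩ | ⟨h, _⟩ <;> rw [h] <;> constructor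
    all_goals
      intro H
      refine ⟨?_, ?_⟩
    all_goals first
      | linarith [H.1, H.2]
      | linarith [H.1.1, H.1.2, H.2.1, H.2.2]
      | constructor <;> linarith [H.1, H.2]
  rw [this, Real.volume_Icc]
  congr 1; ring

lemma dens_eq (a : ℝ) (ha : 0 < a) (t : ℝ) :
    ENNReal.ofReal (angleDensity a t)
      = (ENNReal.ofReal (2 * a))⁻¹ * (ENNReal.ofReal (2 * a))⁻¹ *
        (ENNReal.ofReal 2 * ENNReal.ofReal (2 * (a - |t|))) := by
  rw [← ENNReal.ofReal_inv_of_pos (by positivity), ← ENNReal.ofReal_mul (by positivity),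
    ← ENNReal.ofReal_mul (by positivity), ← ENNReal.ofReal_mul (by positivity)]
  unfold angleDensity
  split_ifs with h
  · congr 1
    field_simp
  · have h2 : a < |t| := by
      by_contra h3
      exact h (abs_le.mp (not_lt.mp h3))
    rw [ENNReal.ofReal_zero, eq_comm, ENNReal.ofReal_eq_zero]
    apply mul_nonpos_of_nonneg_of_nonpos (by positivity)
    linarith

lemma map_eq (a : ℝ) (ha : 0 < a) (ha' : a ≤ π / 2) :
    (Measure.map
        (fun p : ℝ × ℝ =>
          Complex.arg (Complex.exp ((p.1 : ℂ) * Complex.I) + Complex.exp ((p.2 : ℂ) * Complex.I)))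
        ((mu a).prod (mu a)))
      = volume.withDensity (fun θ => ENNReal.ofReal (angleDensity a θ)) := by
  have hc : (ENNReal.ofReal (2 * a))⁻¹ ≠ ⊤ := by
    simp [ha]
  have hprod : (mu a).prod (mu a) =
      ((ENNReal.ofReal (2 * a))⁻¹ * (ENNReal.ofReal (2 * a))⁻¹) •
        ((volume : Measure ℝ).prod volume).restrict (Set.Icc (-a) a ×ˢ Set.Icc (-a) a) := by
    unfold mu
    rw [← Measure.prod_restrict, Measure.prod_smul_left, Measure.prod_smul_right, smul_smul]
  rw [hprod]
  ext S hS
  have hmeas : Measurable (fun p : ℝ × ℝ =>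
          Complex.arg (Complex.exp ((p.1 : ℂ) * Complex.I) + Complex.exp ((p.2 : ℂ) * Complex.I))) := by
    fun_prop
  rw [Measure.map_apply hmeas hS, Measure.smul_apply, Measure.restrict_apply (hmeas hS)]
  set I := Set.Icc (-a) a with hI
  have hB : (fun p : ℝ × ℝ =>
          Complex.arg (Complex.exp ((p.1 : ℂ) * Complex.I) + Complex.exp ((p.2 : ℂ) * Complex.I))) ⁻¹' S
        ∩ I ×ˢ I = ((fun p : ℝ × ℝ => (p.1 + p.2) / 2) ⁻¹' S) ∩ I ×ˢ I := by
    ext ⟨x, y⟩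
    simp only [Set.mem_inter_iff, Set.mem_preimage, Set.mem_prod]
    refine and_congr_left fun h => ?_
    rw [arg_half a ha' x y h.1 h.2]
  rw [hB]
  have hIm : MeasurableSet I := measurableSet_Icc
  have hBm : MeasurableSet (((fun p : ℝ × ℝ => (p.1 + p.2) / 2) ⁻¹' S) ∩ I ×ˢ I) := by
    apply MeasurableSet.inter _ (hIm.prod hIm)
    exact (by fun_prop : Measurable (fun p : ℝ × ℝ => (p.1 + p.2) / 2)) hS
  set B := ((fun p : ℝ × ℝ => (p.1 + p.2) / 2) ⁻¹' S) ∩ I ×ˢ I with hBdef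
  have hind : Measurable (B.indicator (1 : ℝ × ℝ → ENNReal)) := measurable_one.indicator hBm
  have e1 : ((volume : Measure ℝ).prod volume) B
      = ENNReal.ofReal 2 * ∫⁻ t, ∫⁻ x, B.indicator (1 : ℝ × ℝ → ENNReal) (x, 2 * t - x) := by
    rw [← lintegral_indicator_one hBm, lintegral_prod _ hind.aemeasurable]
    have : ∀ x : ℝ, ∫⁻ y, B.indicator (1 : ℝ × ℝ → ENNReal) (x, y)
        = ENNReal.ofReal 2 * ∫⁻ t, B.indicator (1 : ℝ × ℝ → ENNReal) (x, 2 * t - x) := fun x =>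
      lint_sub (fun y => B.indicator (1 : ℝ × ℝ → ENNReal) (x, y))
        (hind.comp (by fun_prop)) x
    simp_rw [this]
    rw [lintegral_const_mul' _ _ ENNReal.ofReal_ne_top, lintegral_lintegral_swap]
    exact (hind.comp (by fun_prop : Measurable
      (fun p : ℝ × ℝ => (p.1, 2 * p.2 - p.1)))).aemeasurable
  have e2 : ∀ t, ∫⁻ x, B.indicator (1 : ℝ × ℝ → ENNReal) (x, 2 * t - x)
      = S.indicator (fun t => ENNReal.ofReal (2 * (a - |t|))) t := by
    intro t
    have hJ : MeasurableSet {x : ℝ | x ∈ I ∧ 2 * t - x ∈ I} :=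
      hIm.inter ((by fun_prop : Measurable (fun x : ℝ => 2 * t - x)) hIm)
    by_cases ht : t ∈ S
    · rw [Set.indicator_of_mem ht, ← vol_slice, ← lintegral_indicator_one hJ]
      congr 1
      ext x
      have : (x, 2 * t - x) ∈ B ↔ x ∈ {x : ℝ | x ∈ I ∧ 2 * t - x ∈ I} := by
        simp [hBdef, ht]
      by_cases hx : (x, 2 * t - x) ∈ B
      · rw [Set.indicator_of_mem hx, Set.indicator_of_mem (this.mp hx)]; rfl
      · rw [Set.indicator_of_notMem hx, Set.indicator_of_notMem (fun h => hx (this.mpr h))]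
    · rw [Set.indicator_of_notMem ht]
      have : ∀ x, B.indicator (1 : ℝ × ℝ → ENNReal) (x, 2 * t - x) = 0 := fun x =>
        Set.indicator_of_notMem (by simp [hBdef, ht]) _
      simp [this]
  simp_rw [e2] at e1
  rw [e1, lintegral_indicator hS, withDensity_apply _ hS]
  simp_rw [dens_eq a ha]
  rw [lintegral_const_mul' _ _ (ENNReal.mul_ne_top hc hc),
    lintegral_const_mul' _ _ ENNReal.ofReal_ne_top, smul_eq_mul]

theorem stmt3 (a : ℝ) (ha : 0 < a) (ha' : a ≤ π / 2) :
    (Measure.map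
        (fun p : ℝ × ℝ =>
          Complex.arg (Complex.exp ((p.1 : ℂ) * Complex.I) + Complex.exp ((p.2 : ℂ) * Complex.I)))
        ((mu a).prod (mu a))) ≪ volume ∧
    (Measure.map
        (fun p : ℝ × ℝ =>
          Complex.arg (Complex.exp ((p.1 : ℂ) * Complex.I) + Complex.exp ((p.2 : ℂ) * Complex.I)))
        ((mu a).prod (mu a)))
      = volume.withDensity (fun θ => ENNReal.ofReal (angleDensity a θ)) := by
  rw [map_eq a ha ha']
  exact ⟨withDensity_absolutelyContinuous _ _, rfl⟩
end

section
/- Let Ω = ℝ² be equipped with the probability measure P = μ_a ⊗ μ_a, let φ₂ : Ω → ℝ be the second coordinate projection, and let Θ : Ω → ℝ be defined by Θ(φ₁, φ₂) = (φ₁ + φ₂)/2. Then, for (law of Θ)-almost every θ ∈ [−a, a], a regular conditional distribution of φ₂ given Θ = θ is the uniform probability measure on the interval [max(−a, 2θ − a), min(a, 2θ + a)]. -/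
open MeasureTheory Real ProbabilityTheory

/-- The uniform probability measure on the interval `[c, d]`:
Lebesgue measure restricted to `[c, d]`, normalized by `1/(d - c)`. -/
noncomputable def unif (c d : ℝ) : Measure ℝ :=
  (ENNReal.ofReal (d - c))⁻¹ • volume.restrict (Set.Icc c d)

lemma aux_scale (f : ℝ → ENNReal) (hf : Measurable f) (y : ℝ) :
    ∫⁻ x, f ((x + y) / 2) = 2 * ∫⁻ t, f t := by
  rw [lintegral_add_right_eq_self (fun x => f (x / 2)) y]
  have h := Real.map_volume_mul_left (a := (2:ℝ)⁻¹) (by norm_num)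
  have h2 : ∫⁻ t, f t ∂(Measure.map ((2:ℝ)⁻¹ * ·) volume) = ∫⁻ x, f (x / 2) := by
    rw [lintegral_map hf (by fun_prop)]
    congr 1; ext x; congr 1; ring
  rw [← h2, h, lintegral_smul_measure]
  simp

lemma aux_L (a : ℝ) (g : ℝ × ℝ → ENNReal) (hg : Measurable g) :
    ∫⁻ p, g ((p.1 + p.2) / 2, p.2) ∂((mu a).prod (mu a)) =
      (ENNReal.ofReal (2 * a))⁻¹ * ((ENNReal.ofReal (2 * a))⁻¹ * (2 * ∫⁻ t,
        ∫⁻ y in Set.Icc (max (-a) (2 * t - a)) (min a (2 * t + a)), g (t, y))) := by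
  have hG : Measurable (fun p : ℝ × ℝ => (Set.Icc (-a) a).indicator (fun _ => (1:ENNReal)) p.2 *
      ((Set.Icc (-a) a).indicator (fun _ => (1:ENNReal)) (2 * p.1 - p.2) * g p)) := by
    have h1 : Measurable ((Set.Icc (-a) a).indicator (fun _ => (1:ENNReal))) :=
      measurable_const.indicator measurableSet_Icc
    exact (h1.comp measurable_snd).mul ((h1.comp (by fun_prop)).mul hg)
  unfold mu
  rw [Measure.prod_smul_left, Measure.prod_smul_right, lintegral_smul_measure,
    lintegral_smul_measure, smul_eq_mul, smul_eq_mul]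
  congr 2
  rw [lintegral_prod_symm' _ (by fun_prop), ← lintegral_indicator measurableSet_Icc]
  have : ∀ y : ℝ, (Set.Icc (-a) a).indicator (fun y => ∫⁻ x in Set.Icc (-a) a,
      g ((x + y) / 2, y)) y = 2 * ∫⁻ t, (Set.Icc (-a) a).indicator (fun _ => (1:ENNReal)) y *
      ((Set.Icc (-a) a).indicator (fun _ => (1:ENNReal)) (2 * t - y) * g (t, y)) := by
    intro y
    rw [← aux_scale (fun t => (Set.Icc (-a) a).indicator (fun _ => (1:ENNReal)) y *
      ((Set.Icc (-a) a).indicator (fun _ => (1:ENNReal)) (2 * t - y) * g (t, y)))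
      (hG.comp (measurable_id.prodMk measurable_const)) y]
    by_cases hy : y ∈ Set.Icc (-a) a
    · rw [Set.indicator_of_mem hy, ← lintegral_indicator measurableSet_Icc]
      congr 1; ext x
      have e : 2 * ((x + y) / 2) - y = x := by ring
      by_cases hx : x ∈ Set.Icc (-a) a <;> simp [hx, hy, e, -Set.mem_Icc]
    · simp [hy, -Set.mem_Icc]
  simp_rw [this]
  rw [lintegral_const_mul _ (hG.lintegral_prod_left' ), 
    lintegral_lintegral_swap (f := fun y t => (Set.Icc (-a) a).indicator
      (fun _ => (1:ENNReal)) y * ((Set.Icc (-a) a).indicator (fun _ => (1:ENNReal)) (2 * t - y) *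
      g (t, y))) (hG.comp measurable_swap).aemeasurable]
  congr 2; ext t
  rw [← lintegral_indicator measurableSet_Icc]
  congr 1; ext y
  have : y ∈ Set.Icc (max (-a) (2 * t - a)) (min a (2 * t + a)) ↔
      y ∈ Set.Icc (-a) a ∧ 2 * t - y ∈ Set.Icc (-a) a := by
    simp only [Set.mem_Icc, max_le_iff, le_min_iff]
    constructor
    · rintro ⟨⟨_, _⟩, _, _⟩; refine ⟨⟨?_, ?_⟩, ?_, ?_⟩ <;> linarith
    · rintro ⟨⟨_, _⟩, _, _⟩; refine ⟨⟨?_, ?_⟩, ?_, ?_⟩ <;> linarith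
  by_cases h1 : y ∈ Set.Icc (-a) a <;> by_cases h2 : 2 * t - y ∈ Set.Icc (-a) a <;>
    simp [Set.indicator, this, h1, h2, -Set.mem_Icc]

lemma aux_meas (a : ℝ) :
    Measurable (fun t : ℝ => unif (max (-a) (2 * t - a)) (min a (2 * t + a))) := by
  refine Measure.measurable_of_measurable_coe _ fun s hs => ?_
  have hS : MeasurableSet {p : ℝ × ℝ | p.2 ∈ s ∧ max (-a) (2 * p.1 - a) ≤ p.2 ∧
      p.2 ≤ min a (2 * p.1 + a)} := by
    refine (measurable_snd hs).inter (MeasurableSet.inter ?_ ?_)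
    · exact measurableSet_le (f := fun p : ℝ × ℝ => max (-a) (2 * p.1 - a))
        (g := fun p : ℝ × ℝ => p.2) (by fun_prop) (by fun_prop)
    · exact measurableSet_le (f := fun p : ℝ × ℝ => p.2)
        (g := fun p : ℝ × ℝ => min a (2 * p.1 + a)) (by fun_prop) (by fun_prop)
  have := measurable_measure_prodMk_left (ν := (volume : Measure ℝ)) hS
  simp only [unif, Measure.smul_apply, smul_eq_mul, Measure.restrict_apply hs]
  refine Measurable.mul (by fun_prop) ?_
  exact this

theorem stmt7 (a : ℝ) (ha : 0 < a) (ha' : a ≤ π / 2) :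
    ∃ κ : Kernel ℝ ℝ, IsMarkovKernel κ ∧
      (∀ᵐ θ ∂(Measure.map (fun p : ℝ × ℝ => (p.1 + p.2) / 2) ((mu a).prod (mu a))),
        κ θ = unif (max (-a) (2 * θ - a)) (min a (2 * θ + a))) ∧
      Measure.map (fun p : ℝ × ℝ => ((p.1 + p.2) / 2, p.2)) ((mu a).prod (mu a))
        = (Measure.map (fun p : ℝ × ℝ => (p.1 + p.2) / 2) ((mu a).prod (mu a))).compProd κ := by
  classical
  have hE : MeasurableSet {t : ℝ | max (-a) (2 * t - a) < min a (2 * t + a)} :=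
    measurableSet_lt (by fun_prop) (by fun_prop)
  let κ : Kernel ℝ ℝ := ⟨fun t => if max (-a) (2 * t - a) < min a (2 * t + a) then
    unif (max (-a) (2 * t - a)) (min a (2 * t + a)) else Measure.dirac 0,
    Measurable.ite hE (aux_meas a) measurable_const⟩
  have hκ1 : ∀ t, max (-a) (2 * t - a) < min a (2 * t + a) →
      κ t = unif (max (-a) (2 * t - a)) (min a (2 * t + a)) := fun t ht => if_pos ht
  have hκ2 : ∀ t, ¬ max (-a) (2 * t - a) < min a (2 * t + a) →
      κ t = Measure.dirac 0 := fun t ht => if_neg ht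
  have hM : IsMarkovKernel κ := by
    refine ⟨fun t => ⟨?_⟩⟩
    by_cases ht : max (-a) (2 * t - a) < min a (2 * t + a)
    · rw [hκ1 t ht, unif, Measure.smul_apply, Measure.restrict_apply_univ, Real.volume_Icc,
        smul_eq_mul]
      refine ENNReal.inv_mul_cancel ?_ ENNReal.ofReal_ne_top
      exact (ENNReal.ofReal_pos.2 (sub_pos.2 ht)).ne'
    · rw [hκ2 t ht]; simp
  have : IsFiniteMeasure (mu a) := by
    refine ⟨?_⟩
    rw [mu, Measure.smul_apply, smul_eq_mul, Measure.restrict_apply_univ, Real.volume_Icc]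
    refine ENNReal.mul_lt_top ?_ ENNReal.ofReal_lt_top
    simp [ha]
  have hT : Measurable (fun p : ℝ × ℝ => (p.1 + p.2) / 2) := by fun_prop
  refine ⟨κ, hM, ?_, ?_⟩
  · have key : ∀ᵐ t ∂(Measure.map (fun p : ℝ × ℝ => (p.1 + p.2) / 2) ((mu a).prod (mu a))),
        t ∈ {t : ℝ | max (-a) (2 * t - a) < min a (2 * t + a)} := by
      rw [ae_iff]
      change (Measure.map _ _) {t : ℝ | max (-a) (2 * t - a) < min a (2 * t + a)}ᶜ = 0
      rw [← lintegral_indicator_one hE.compl, lintegral_map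
        (measurable_one.indicator hE.compl) hT]
      have hm : Measurable (fun q : ℝ × ℝ => ({t : ℝ | max (-a) (2 * t - a) <
        min a (2 * t + a)}ᶜ).indicator (1 : ℝ → ENNReal) q.1) :=
        (measurable_one.indicator hE.compl).comp measurable_fst
      refine (aux_L a _ hm).trans ?_
      have : ∀ t : ℝ, ∫⁻ y in Set.Icc (max (-a) (2 * t - a)) (min a (2 * t + a)),
        ({t : ℝ | max (-a) (2 * t - a) <
        min a (2 * t + a)}ᶜ).indicator (1 : ℝ → ENNReal) t = 0 := by
        intro t
        rw [lintegral_const, Measure.restrict_apply_univ, Real.volume_Icc, mul_eq_zero]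
        by_cases ht : max (-a) (2 * t - a) < min a (2 * t + a)
        · left; rw [Set.indicator_of_notMem]; exact fun h => h ht
        · right; rw [ENNReal.ofReal_eq_zero]; linarith
      simp only [this]
      simp
    filter_upwards [key] with t ht using hκ1 t ht
  · ext s hs
    have hG : Measurable (fun t => κ t (Prod.mk t ⁻¹' s)) :=
      Kernel.measurable_kernel_prodMk_left hs
    rw [Measure.compProd_apply hs, lintegral_map hG hT, ← lintegral_indicator_one hs,
      lintegral_map (measurable_one.indicator hs) (by fun_prop),
      aux_L a _ (measurable_one.indicator hs)]
    refine Eq.trans ?_ (aux_L a _ (hG.comp measurable_fst)).symm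
    congr 4; ext t
    simp only [Function.comp]
    have e : ∀ y, s.indicator (1 : ℝ × ℝ → ENNReal) (t, y) =
      (Prod.mk t ⁻¹' s).indicator (1 : ℝ → ENNReal) y := fun y => rfl
    have hs' : MeasurableSet (Prod.mk t ⁻¹' s) := measurable_prodMk_left hs
    simp only [e]
    rw [lintegral_indicator_one hs', lintegral_const, Measure.restrict_apply_univ,
      Real.volume_Icc]
    by_cases ht : max (-a) (2 * t - a) < min a (2 * t + a)
    · rw [hκ1 t ht, unif, Measure.smul_apply, smul_eq_mul, mul_right_comm,
        ENNReal.inv_mul_cancel, one_mul]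
      · exact (ENNReal.ofReal_pos.2 (sub_pos.2 ht)).ne'
      · exact ENNReal.ofReal_ne_top
    · have h0 : ENNReal.ofReal (min a (2 * t + a) - max (-a) (2 * t - a)) = 0 := by
        rw [ENNReal.ofReal_eq_zero]; linarith
      rw [h0, mul_zero]
      refine le_antisymm ((measure_mono (Set.subset_univ _)).trans ?_) bot_le
      rw [Measure.restrict_apply_univ, Real.volume_Icc, h0]
end

section
/- Let N ≥ 2 be an integer. Then the topological frontier (boundary) of S_N as a subset of ℂ equals C_out ∪ C_in. -/
open Real

/-- The set of points reachable by the `N`-step random walk with angles in `[-a, a]`. -/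
def walkSupport (a : ℝ) (N : ℕ) : Set ℂ :=
  {z | ∃ φ : Fin N → ℝ, (∀ i, φ i ∈ Set.Icc (-a) a) ∧
    z = ∑ i, Complex.exp ((φ i : ℂ) * Complex.I)}

/-- The outer boundary curve of the support. -/
def Cout (a : ℝ) (N : ℕ) : Set ℂ :=
  {z | ∃ φ ∈ Set.Icc (-a) a, z = (N : ℂ) * Complex.exp ((φ : ℂ) * Complex.I)}

/-- The inner boundary curve of the support. -/
def Cin (a : ℝ) (N : ℕ) : Set ℂ :=
  {z | ∃ k : ℕ, k ≤ N - 1 ∧ ∃ φ ∈ Set.Icc (-a) a,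
    z = (k : ℂ) * Complex.exp ((a : ℂ) * Complex.I)
      + ((N - 1 - k : ℕ) : ℂ) * Complex.exp (-(a : ℂ) * Complex.I)
      + Complex.exp ((φ : ℂ) * Complex.I)}

noncomputable def hh (s : ℝ) : ℝ := √(1 - s ^ 2)

lemma hh_cont : Continuous hh := by unfold hh; fun_prop

lemma hh_neg (s : ℝ) : hh (-s) = hh s := by simp [hh]

lemma hh_concave : ConcaveOn ℝ (Set.Icc (-1) 1) hh := by
  refine ⟨convex_Icc _ _, ?_⟩
  intro x hx y hy p q hp hq hpq
  simp only [smul_eq_mul, hh]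
  have hx' : 0 ≤ 1 - x ^ 2 := by nlinarith [hx.1, hx.2]
  have hy' : 0 ≤ 1 - y ^ 2 := by nlinarith [hy.1, hy.2]
  apply Real.le_sqrt_of_sq_le
  have e1 := Real.sq_sqrt hx'
  have e2 := Real.sq_sqrt hy'
  set u := √(1 - x ^ 2)
  set v := √(1 - y ^ 2)
  have hq' : q = 1 - p := by linarith
  have h1 : u * v + x * y ≤ 1 := by nlinarith [sq_nonneg (u - v), sq_nonneg (x - y)]
  have h2 : 0 ≤ p * q * (1 - (u * v + x * y)) :=
    mul_nonneg (mul_nonneg hp hq) (by linarith)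
  have e : 1 - (p * x + q * y) ^ 2 - (p * u + q * v) ^ 2
      = 1 - p ^ 2 * (x ^ 2 + u ^ 2) - q ^ 2 * (y ^ 2 + v ^ 2) - 2 * (p * q) * (u * v + x * y) := by
    ring
  rw [show x ^ 2 + u ^ 2 = 1 by linarith, show y ^ 2 + v ^ 2 = 1 by linarith] at e
  have e3 : (p + q) ^ 2 = 1 := by rw [hpq]; norm_num
  nlinarith

lemma merge_pos {c : ℝ} (hc1 : c ≤ 1) {s t : ℝ} (hs : s ∈ Set.Icc (-c) c)
    (ht : t ∈ Set.Icc (-c) c) (h : 0 ≤ s + t) :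
    hh c + hh (s + t - c) ≤ hh s + hh t := by
  obtain ⟨hs1, hs2⟩ := hs
  obtain ⟨ht1, ht2⟩ := ht
  rcases eq_or_ne (s + t) (2 * c) with e | e
  · have : s = c := by linarith
    have : t = c := by linarith
    subst s; subst t; simp
  · have hlt : s + t < 2 * c := lt_of_le_of_ne (by linarith) e
    have hd : 0 < 2 * c - (s + t) := by linarith
    have hd' := hd.ne'
    set l := (c - t) / (2 * c - (s + t)) with hl
    set m := (c - s) / (2 * c - (s + t)) with hm
    have hl0 : 0 ≤ l := div_nonneg (by linarith) hd.le
    have hm0 : 0 ≤ m := div_nonneg (by linarith) hd.le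
    have hlm : l + m = 1 := by rw [hl, hm, ← add_div, div_eq_one_iff_eq hd']; ring
    have hcm : c ∈ Set.Icc (-1 : ℝ) 1 := ⟨by linarith, hc1⟩
    have hrm : s + t - c ∈ Set.Icc (-1 : ℝ) 1 := ⟨by linarith, by linarith⟩
    have A := hh_concave.2 hcm hrm hl0 hm0 hlm
    have B := hh_concave.2 hcm hrm hm0 hl0 (by linarith)
    simp only [smul_eq_mul] at A B
    have ea : l * c + m * (s + t - c) = s := by
      rw [hl, hm, div_mul_eq_mul_div, div_mul_eq_mul_div, ← add_div, div_eq_iff hd']; ring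
    have eb : m * c + l * (s + t - c) = t := by
      rw [hl, hm, div_mul_eq_mul_div, div_mul_eq_mul_div, ← add_div, div_eq_iff hd']; ring
    rw [ea] at A
    rw [eb] at B
    have : m = 1 - l := by linarith
    rw [this] at A B
    linarith

lemma min_exists {c : ℝ} (hc1 : c ≤ 1) (n : ℕ) (s : Fin (n + 1) → ℝ)
    (hs : ∀ i, s i ∈ Set.Icc (-c) c) :
    ∃ k : ℕ, k ≤ n ∧ ∃ r ∈ Set.Icc (-c) c, ∑ i, s i = (2 * k - n : ℝ) * c + r ∧
      n * hh c + hh r ≤ ∑ i, hh (s i) := by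
  induction n with
  | zero => exact ⟨0, le_rfl, s 0, hs 0, by simp, by simp⟩
  | succ n ih =>
    obtain ⟨k, hk, r, hr, e, h⟩ := ih (fun i => s i.succ) (fun i => hs _)
    rw [Fin.sum_univ_succ (n := n + 1), Fin.sum_univ_succ (n := n + 1)]
    have h0 := hs 0
    rcases le_total 0 (s 0 + r) with hp | hp
    · refine ⟨k + 1, by omega, s 0 + r - c, ⟨by linarith, by linarith [h0.2, hr.2]⟩, ?_, ?_⟩
      · push_cast; linarith
      · have := merge_pos hc1 h0 hr hp
        push_cast; linarith
    · refine ⟨k, by omega, s 0 + r + c, ⟨by linarith [h0.1, hr.1], by linarith⟩, ?_, ?_⟩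
      · push_cast; linarith
      · have := merge_pos hc1 (s := -s 0) (t := -r) ⟨by linarith [h0.2], by linarith [h0.1]⟩
          ⟨by linarith [hr.2], by linarith [hr.1]⟩ (by linarith)
        rw [show -s 0 + -r - c = -(s 0 + r + c) by ring, hh_neg, hh_neg, hh_neg] at this
        push_cast; linarith

lemma rep_unique_aux {c : ℝ} (hc : 0 < c) {k k' : ℕ} {n r r' : ℝ}
    (hr : r ∈ Set.Icc (-c) c) (hr' : r' ∈ Set.Icc (-c) c) (hk : k < k')
    (e : (2 * k - n : ℝ) * c + r = (2 * k' - n : ℝ) * c + r') : hh r = hh r' := by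
  have h1 : (k : ℝ) + 1 ≤ k' := by exact_mod_cast hk
  have h2 : 0 ≤ ((k' : ℝ) - k - 1) * c := mul_nonneg (by linarith) hc.le
  have e1 : r = c := by nlinarith [hr.2, hr'.1]
  have e2 : r' = -c := by nlinarith [hr.2, hr'.1]
  rw [e1, e2, hh_neg]

lemma rep_unique {c : ℝ} (hc : 0 < c) {k k' : ℕ} {n r r' : ℝ}
    (hr : r ∈ Set.Icc (-c) c) (hr' : r' ∈ Set.Icc (-c) c)
    (e : (2 * k - n : ℝ) * c + r = (2 * k' - n : ℝ) * c + r') : hh r = hh r' := by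
  rcases lt_trichotomy k k' with h | h | h
  · exact rep_unique_aux hc hr hr' h e
  · subst h; rw [add_left_cancel e]
  · exact (rep_unique_aux hc hr' hr h e.symm).symm

lemma min_le {c : ℝ} (hc : 0 < c) (hc1 : c ≤ 1) (n : ℕ) (s : Fin (n + 1) → ℝ)
    (hs : ∀ i, s i ∈ Set.Icc (-c) c) (k : ℕ) (r : ℝ) (hr : r ∈ Set.Icc (-c) c)
    (e : ∑ i, s i = (2 * k - n : ℝ) * c + r) : n * hh c + hh r ≤ ∑ i, hh (s i) := by
  obtain ⟨k', _, r', hr', e', h⟩ := min_exists hc1 n s hs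
  rw [rep_unique hc hr hr' (e.symm.trans e')]
  exact h

lemma le_max {c : ℝ} (hc1 : c ≤ 1) (n : ℕ) (s : Fin (n + 1) → ℝ)
    (hs : ∀ i, s i ∈ Set.Icc (-c) c) :
    ∑ i, hh (s i) ≤ (n + 1) * hh ((∑ i, s i) / (n + 1)) := by
  have hn : (0 : ℝ) < n + 1 := by positivity
  have := hh_concave.le_map_sum (t := Finset.univ) (w := fun _ : Fin (n + 1) => 1 / ((n : ℝ) + 1))
    (p := s) (fun _ _ => by positivity) (by simp; field_simp)
    (fun i _ => ⟨by linarith [(hs i).1], by linarith [(hs i).2]⟩)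
  simp only [smul_eq_mul, ← Finset.mul_sum] at this
  rw [one_div, ← div_eq_inv_mul, ← div_eq_inv_mul, div_le_iff₀ hn] at this
  linarith

/-- continuous selection -/
noncomputable def sel (c M y : ℝ) {m : ℕ} (s : Fin m → ℝ) (y' : ℝ) (i : Fin m) : ℝ :=
  s i + max 0 (y' - y) / (M - y) * (c - s i) - max 0 (y - y') / (M + y) * (s i + c)

lemma sel_cont (c M y : ℝ) {m : ℕ} (s : Fin m → ℝ) (i : Fin m) :
    Continuous (fun y' => sel c M y s y' i) := by unfold sel; fun_prop

lemma sel_self (c M y : ℝ) {m : ℕ} (s : Fin m → ℝ) : sel c M y s y = s := by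
  ext i; simp [sel]

lemma sel_mem {c M y : ℝ} {m : ℕ} {s : Fin m → ℝ} (hs : ∀ i, s i ∈ Set.Icc (-c) c)
    (h1 : y < M) (h2 : -M < y) {y' : ℝ} (h1' : y' ≤ M) (h2' : -M ≤ y') (i : Fin m) :
    sel c M y s y' i ∈ Set.Icc (-c) c := by
  obtain ⟨a1, a2⟩ := hs i
  unfold sel
  rcases le_total y y' with h | h
  · rw [max_eq_right (by linarith : 0 ≤ y' - y), max_eq_left (by linarith : y - y' ≤ 0)]
    have t0 : 0 ≤ (y' - y) / (M - y) := div_nonneg (by linarith) (by linarith)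
    have t1 : (y' - y) / (M - y) ≤ 1 := (div_le_one (by linarith)).2 (by linarith)
    simp only [zero_div, zero_mul, sub_zero]
    constructor <;> nlinarith
  · rw [max_eq_left (by linarith : y' - y ≤ 0), max_eq_right (by linarith : 0 ≤ y - y')]
    have t0 : 0 ≤ (y - y') / (M + y) := div_nonneg (by linarith) (by linarith)
    have t1 : (y - y') / (M + y) ≤ 1 := (div_le_one (by linarith)).2 (by linarith)
    simp only [zero_div, zero_mul, add_zero]
    constructor <;> nlinarith

lemma sel_sum {c M y : ℝ} {m : ℕ} {s : Fin m → ℝ} (hM : M = m * c) (hy : ∑ i, s i = y)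
    (h1 : y < M) (h2 : -M < y) (y' : ℝ) : ∑ i, sel c M y s y' i = y' := by
  unfold sel
  rw [Finset.sum_sub_distrib, Finset.sum_add_distrib, ← Finset.mul_sum, ← Finset.mul_sum,
    Finset.sum_sub_distrib, Finset.sum_add_distrib, hy]
  simp only [Finset.sum_const, Finset.card_univ, Fintype.card_fin, nsmul_eq_mul, ← hM]
  rw [div_mul_cancel₀ _ (by linarith), add_comm y M, div_mul_cancel₀ _ (by linarith)]
  rcases le_total y y' with h | h
  · rw [max_eq_right (by linarith : 0 ≤ y' - y), max_eq_left (by linarith : y - y' ≤ 0)]; ring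
  · rw [max_eq_left (by linarith : y' - y ≤ 0), max_eq_right (by linarith : 0 ≤ y - y')]; ring

/-- real form of the support -/
def RS (c : ℝ) (m : ℕ) : Set ℂ :=
  {z | ∃ s : Fin m → ℝ, (∀ i, s i ∈ Set.Icc (-c) c) ∧ z.re = ∑ i, hh (s i) ∧ z.im = ∑ i, s i}

lemma RS_closed (c : ℝ) (m : ℕ) : IsClosed (RS c m) := by
  have hK : IsCompact (Set.pi Set.univ (fun _ : Fin m => Set.Icc (-c) c)) :=
    isCompact_univ_pi (fun _ => isCompact_Icc)
  have hcont : Continuous (fun s : Fin m → ℝ =>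
      (((∑ i, hh (s i) : ℝ) : ℂ) + ((∑ i, s i : ℝ) : ℂ) * Complex.I)) := by
    have := hh_cont
    fun_prop
  convert (hK.image hcont).isClosed using 1
  ext z
  simp only [RS, Set.mem_ofPred_eq, Set.mem_image, Set.mem_univ_pi]
  constructor
  · rintro ⟨s, hs, h1, h2⟩
    refine ⟨s, hs, ?_⟩
    rw [← h1, ← h2, Complex.re_add_im]
  · rintro ⟨s, hs, rfl⟩
    exact ⟨s, hs, by simp, by simp⟩

lemma seg_mem {c : ℝ} {m : ℕ} {s t : Fin m → ℝ} (hs : ∀ i, s i ∈ Set.Icc (-c) c)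
    (ht : ∀ i, t i ∈ Set.Icc (-c) c) {z : ℂ} (h1 : ∑ i, s i = z.im) (h2 : ∑ i, t i = z.im)
    (h3 : ∑ i, hh (s i) ≤ z.re) (h4 : z.re ≤ ∑ i, hh (t i)) : z ∈ RS c m := by
  have hc : ContinuousOn (fun l : ℝ => ∑ i, hh ((1 - l) * s i + l * t i)) (Set.Icc 0 1) := by
    have := hh_cont
    fun_prop
  have := intermediate_value_Icc (zero_le_one' ℝ) hc
  obtain ⟨l, hl, e⟩ := this (show z.re ∈ _ from ⟨by simpa using h3, by simpa using h4⟩)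
  refine ⟨fun i => (1 - l) * s i + l * t i, ?_, e.symm, ?_⟩
  · intro i
    have := (convex_Icc (-c) c) (hs i) (ht i) (sub_nonneg.2 hl.2) hl.1 (by ring)
    simpa using this
  · rw [Finset.sum_add_distrib, ← Finset.mul_sum, ← Finset.mul_sum, h1, h2]; ring

lemma interior_mem {c : ℝ} {m : ℕ} {s t : Fin m → ℝ} (hs : ∀ i, s i ∈ Set.Icc (-c) c)
    (ht : ∀ i, t i ∈ Set.Icc (-c) c) {z : ℂ} (h1 : ∑ i, s i = z.im) (h2 : ∑ i, t i = z.im)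
    (h3 : ∑ i, hh (s i) < z.re) (h4 : z.re < ∑ i, hh (t i)) (h5 : z.im < m * c)
    (h6 : -(m * c) < z.im) : z ∈ interior (RS c m) := by
  rw [mem_interior_iff_mem_nhds]
  have hc := hh_cont
  have key : ∀ u : Fin m → ℝ, Continuous (fun w : ℂ => ∑ i, hh (sel c (m * c) z.im u w.im i)) := by
    intro u
    refine continuous_finsetSum _ (fun i _ => hc.comp ((sel_cont _ _ _ _ i).comp Complex.continuous_im))
  have E1 : ∀ᶠ w in nhds z, ∑ i, hh (sel c (m * c) z.im s w.im i) < w.re :=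
    (key s).continuousAt.eventually_lt Complex.continuous_re.continuousAt (by simpa [sel_self] using h3)
  have E2 : ∀ᶠ w in nhds z, w.re < ∑ i, hh (sel c (m * c) z.im t w.im i) :=
    Complex.continuous_re.continuousAt.eventually_lt (key t).continuousAt (by simpa [sel_self] using h4)
  have E3 : ∀ᶠ w in nhds z, w.im < m * c :=
    Complex.continuous_im.continuousAt.eventually_lt continuousAt_const h5
  have E4 : ∀ᶠ w in nhds z, -(m * c) < w.im :=
    continuousAt_const.eventually_lt Complex.continuous_im.continuousAt h6
  filter_upwards [E1, E2, E3, E4] with w w1 w2 w3 w4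
  exact seg_mem (sel_mem hs h5 h6 w3.le w4.le) (sel_mem ht h5 h6 w3.le w4.le)
    (sel_sum rfl h1 h5 h6 _) (sel_sum rfl h2 h5 h6 _) w1.le w2.le

lemma RS_frontier {c : ℝ} (hc : 0 < c) (hc1 : c ≤ 1) (n : ℕ) :
    frontier (RS c (n + 1)) =
      {z | ∃ s ∈ Set.Icc (-c) c, z.re = (n + 1) * hh s ∧ z.im = (n + 1) * s} ∪
      {z | ∃ k : ℕ, k ≤ n ∧ ∃ r ∈ Set.Icc (-c) c, z.re = n * hh c + hh r ∧
        z.im = (2 * k - n : ℝ) * c + r} := by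
  have hn : (0 : ℝ) < n + 1 := by positivity
  rw [(RS_closed c (n + 1)).frontier_eq]
  -- line through z
  have line : ∀ z ∈ interior (RS c (n + 1)),
      (∃ e > (0 : ℝ), z + (e : ℂ) ∈ RS c (n + 1)) ∧ (∃ e > (0 : ℝ), z - (e : ℂ) ∈ RS c (n + 1)) := by
    intro z hz
    rw [mem_interior_iff_mem_nhds, Metric.mem_nhds_iff] at hz
    obtain ⟨e, he, hb⟩ := hz
    refine ⟨⟨e / 2, by linarith, hb ?_⟩, ⟨e / 2, by linarith, hb ?_⟩⟩
    · rw [Metric.mem_ball, dist_eq_norm, add_sub_cancel_left, Complex.norm_real, Real.norm_eq_abs,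
        abs_of_pos (by linarith)]
      linarith
    · rw [Metric.mem_ball, dist_eq_norm, sub_sub_cancel_left, norm_neg, Complex.norm_real,
        Real.norm_eq_abs, abs_of_pos (by linarith)]
      linarith
  have hin : ∀ k : ℕ, k ≤ n → ∀ r ∈ Set.Icc (-c) c, ∃ s : Fin (n + 1) → ℝ,
      (∀ i, s i ∈ Set.Icc (-c) c) ∧ ∑ i, hh (s i) = n * hh c + hh r ∧
        ∑ i, s i = (2 * k - n : ℝ) * c + r := by
    intro k hk r hr
    refine ⟨Fin.cons r (fun i : Fin n => if (i : ℕ) < k then c else -c), ?_, ?_, ?_⟩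
    · intro i
      refine Fin.cases ?_ (fun j => ?_) i
      · simpa using hr
      · simp only [Fin.cons_succ]
        split_ifs <;> constructor <;> linarith
    · rw [Fin.sum_univ_succ]
      have : ∀ j : Fin n, hh (if (j : ℕ) < k then c else -c) = hh c := by
        intro j; split_ifs
        · rfl
        · exact hh_neg c
      simp [this]; ring
    · rw [Fin.sum_univ_succ]
      simp only [Fin.cons_zero, Fin.cons_succ]
      rw [Fin.sum_univ_eq_sum_range (fun i => if i < k then c else -c) n]
      obtain ⟨d, rfl⟩ := Nat.exists_eq_add_of_le hk
      rw [Finset.sum_range_add, Finset.sum_congr rfl (g := fun _ => c)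
        (fun x hx => if_pos (Finset.mem_range.1 hx))]
      simp; ring
  ext z
  constructor
  · rintro ⟨⟨s, hs, hre, him⟩, hint⟩
    by_contra hcon
    simp only [Set.mem_union, not_or] at hcon
    obtain ⟨ho, hi⟩ := hcon
    have lo : -((n + 1) * c) ≤ z.im := by
      rw [him]
      have := Finset.card_nsmul_le_sum Finset.univ s (-c) (fun i _ => (hs i).1)
      simp at this; linarith
    have up : z.im ≤ (n + 1) * c := by
      rw [him]
      have := Finset.sum_le_card_nsmul Finset.univ s c (fun i _ => (hs i).2)
      simp at this; linarith
    have tm : z.im / (n + 1) ∈ Set.Icc (-c) c := by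
      constructor
      · rw [le_div_iff₀ hn]; linarith
      · rw [div_le_iff₀ hn]; linarith
    have hmax := le_max hc1 n s hs
    rw [← hre, ← him] at hmax
    have hlt : z.re < (n + 1) * hh (z.im / (n + 1)) := by
      refine lt_of_le_of_ne hmax (fun e => ho ⟨_, tm, e, ?_⟩)
      field_simp
    obtain ⟨k, hk, r, hr, e, h⟩ := min_exists hc1 n s hs
    rw [← hre] at h
    have hgt : n * hh c + hh r < z.re :=
      lt_of_le_of_ne h (fun e' => hi ⟨k, hk, r, hr, e'.symm, by rw [him, e]⟩)
    have up' : z.im < (n + 1) * c := by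
      refine lt_of_le_of_ne up (fun e' => ?_)
      have := min_le hc hc1 n s hs n c ⟨by linarith, le_rfl⟩ (by rw [← him, e']; ring)
      rw [e', mul_div_cancel_left₀ _ hn.ne'] at hlt
      linarith
    have lo' : -((n + 1) * c) < z.im := by
      refine lt_of_le_of_ne lo (fun e' => ?_)
      have := min_le hc hc1 n s hs 0 (-c) ⟨le_rfl, by linarith⟩
        (by rw [← him, ← e']; push_cast; ring)
      rw [← e', ← mul_neg, mul_div_cancel_left₀ _ hn.ne'] at hlt
      rw [hh_neg] at *
      linarith
    obtain ⟨u, hu, u1, u2⟩ := hin k hk r hr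
    apply hint
    refine interior_mem (s := u) (t := fun _ => z.im / (n + 1)) hu (fun _ => tm) ?_ ?_ ?_ ?_ ?_ ?_
    · rw [u2, him, e]
    · simp; field_simp
    · rw [u1]; exact hgt
    · simpa using hlt
    · simpa using up'
    · simpa using lo'
  · rintro (⟨s, hs, h1, h2⟩ | ⟨k, hk, r, hr, h1, h2⟩)
    · refine ⟨⟨fun _ => s, fun _ => hs, by simpa using h1, by simpa using h2⟩, fun hz => ?_⟩
      obtain ⟨⟨e, he, t, ht, t1, t2⟩, -⟩ := line z hz
      have := le_max hc1 n t ht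
      rw [← t1, ← t2] at this
      simp only [Complex.add_re, Complex.add_im, Complex.ofReal_re, Complex.ofReal_im, add_zero,
        h1, h2] at this
      rw [mul_div_cancel_left₀ _ hn.ne'] at this
      linarith
    · obtain ⟨u, hu, u1, u2⟩ := hin k hk r hr
      refine ⟨⟨u, hu, by rw [u1, h1], by rw [u2, h2]⟩, fun hz => ?_⟩
      obtain ⟨-, ⟨e, he, t, ht, t1, t2⟩⟩ := line z hz
      simp only [Complex.sub_re, Complex.sub_im, Complex.ofReal_re, Complex.ofReal_im, sub_zero]
        at t1 t2
      have := min_le hc hc1 n t ht k r hr (by rw [← t2, h2])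
      linarith

lemma sin_mem {a φ : ℝ} (ha' : a ≤ π / 2) (h : φ ∈ Set.Icc (-a) a) :
    sin φ ∈ Set.Icc (-sin a) (sin a) := by
  obtain ⟨h1, h2⟩ := h
  constructor
  · rw [← sin_neg]
    exact sin_le_sin_of_le_of_le_pi_div_two (by linarith) (by linarith) h1
  · exact sin_le_sin_of_le_of_le_pi_div_two (by linarith) (by linarith) h2

lemma cos_eq {a φ : ℝ} (ha' : a ≤ π / 2) (h : φ ∈ Set.Icc (-a) a) : cos φ = hh (sin φ) :=
  Real.cos_eq_sqrt_one_sub_sin_sq (by linarith [h.1]) (by linarith [h.2])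

lemma arcsin_mem {a s : ℝ} (ha : 0 < a) (ha' : a ≤ π / 2) (h : s ∈ Set.Icc (-sin a) (sin a)) :
    arcsin s ∈ Set.Icc (-a) a := by
  have e : arcsin (sin a) = a := arcsin_sin (by linarith) ha'
  have h1 := monotone_arcsin h.1
  have h2 := monotone_arcsin h.2
  rw [arcsin_neg, e] at h1
  rw [e] at h2
  exact ⟨h1, h2⟩

lemma sin_arcsin_mem {a s : ℝ} (h : s ∈ Set.Icc (-sin a) (sin a)) : sin (arcsin s) = s :=
  sin_arcsin (by linarith [h.1, sin_le_one a]) (by linarith [h.2, sin_le_one a])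

theorem stmt9 (a : ℝ) (ha : 0 < a) (ha' : a ≤ π / 2) (N : ℕ) (hN : 2 ≤ N) :
    frontier (walkSupport a N) = Cout a N ∪ Cin a N := by
  obtain ⟨n, rfl⟩ : ∃ n, N = n + 1 := ⟨N - 1, by omega⟩
  have hc : 0 < sin a := sin_pos_of_pos_of_lt_pi ha (by linarith [pi_pos])
  have hca : cos a = hh (sin a) := cos_eq ha' ⟨by linarith, le_rfl⟩
  have e0 : walkSupport a (n + 1) = RS (sin a) (n + 1) := by
    ext z
    constructor
    · rintro ⟨φ, hφ, rfl⟩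
      refine ⟨fun i => sin (φ i), fun i => sin_mem ha' (hφ i), ?_, ?_⟩
      · rw [Complex.re_sum]
        refine Finset.sum_congr rfl (fun i _ => ?_)
        rw [Complex.exp_ofReal_mul_I_re, cos_eq ha' (hφ i)]
      · rw [Complex.im_sum]
        refine Finset.sum_congr rfl (fun i _ => ?_)
        rw [Complex.exp_ofReal_mul_I_im]
    · rintro ⟨s, hs, h1, h2⟩
      refine ⟨fun i => arcsin (s i), fun i => arcsin_mem ha ha' (hs i), ?_⟩
      apply Complex.ext
      · rw [Complex.re_sum, h1]
        refine Finset.sum_congr rfl (fun i _ => ?_)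
        rw [Complex.exp_ofReal_mul_I_re, cos_eq ha' (arcsin_mem ha ha' (hs i)), sin_arcsin_mem (hs i)]
      · rw [Complex.im_sum, h2]
        refine Finset.sum_congr rfl (fun i _ => ?_)
        rw [Complex.exp_ofReal_mul_I_im, sin_arcsin_mem (hs i)]
  rw [e0, RS_frontier hc (sin_le_one a) n]
  have ore : ∀ φ : ℝ, (((n + 1 : ℕ) : ℂ) * Complex.exp ((φ : ℂ) * Complex.I)).re
      = (n + 1) * cos φ := by
    intro φ
    rw [← Complex.ofReal_natCast, Complex.re_ofReal_mul, Complex.exp_ofReal_mul_I_re]; push_cast; rfl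
  have oim : ∀ φ : ℝ, (((n + 1 : ℕ) : ℂ) * Complex.exp ((φ : ℂ) * Complex.I)).im
      = (n + 1) * sin φ := by
    intro φ
    rw [← Complex.ofReal_natCast, Complex.im_ofReal_mul, Complex.exp_ofReal_mul_I_im]; push_cast; rfl
  have ire : ∀ k : ℕ, k ≤ n → ∀ φ : ℝ, ((k : ℂ) * Complex.exp ((a : ℂ) * Complex.I)
      + ((n + 1 - 1 - k : ℕ) : ℂ) * Complex.exp (-(a : ℂ) * Complex.I)
      + Complex.exp ((φ : ℂ) * Complex.I)).re = n * hh (sin a) + cos φ := by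
    intro k hk φ
    rw [← Complex.ofReal_natCast, ← Complex.ofReal_natCast, ← Complex.ofReal_neg, Complex.add_re,
      Complex.add_re, Complex.re_ofReal_mul, Complex.re_ofReal_mul, Complex.exp_ofReal_mul_I_re,
      Complex.exp_ofReal_mul_I_re, Complex.exp_ofReal_mul_I_re, cos_neg, ← hca,
      Nat.add_sub_cancel, Nat.cast_sub hk]
    ring
  have iim : ∀ k : ℕ, k ≤ n → ∀ φ : ℝ, ((k : ℂ) * Complex.exp ((a : ℂ) * Complex.I)
      + ((n + 1 - 1 - k : ℕ) : ℂ) * Complex.exp (-(a : ℂ) * Complex.I)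
      + Complex.exp ((φ : ℂ) * Complex.I)).im = (2 * k - n : ℝ) * sin a + sin φ := by
    intro k hk φ
    rw [← Complex.ofReal_natCast, ← Complex.ofReal_natCast, ← Complex.ofReal_neg, Complex.add_im,
      Complex.add_im, Complex.im_ofReal_mul, Complex.im_ofReal_mul, Complex.exp_ofReal_mul_I_im,
      Complex.exp_ofReal_mul_I_im, Complex.exp_ofReal_mul_I_im, sin_neg,
      Nat.add_sub_cancel, Nat.cast_sub hk]
    ring
  congr 1
  · ext z
    constructor
    · rintro ⟨s, hs, h1, h2⟩
      refine ⟨arcsin s, arcsin_mem ha ha' hs, Complex.ext ?_ ?_⟩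
      · rw [ore, h1, cos_eq ha' (arcsin_mem ha ha' hs), sin_arcsin_mem hs]
      · rw [oim, h2, sin_arcsin_mem hs]
    · rintro ⟨φ, hφ, rfl⟩
      exact ⟨sin φ, sin_mem ha' hφ, by rw [ore, cos_eq ha' hφ], by rw [oim]⟩
  · ext z
    constructor
    · rintro ⟨k, hk, s, hs, h1, h2⟩
      refine ⟨k, hk, arcsin s, arcsin_mem ha ha' hs, Complex.ext ?_ ?_⟩
      · rw [ire k hk, h1, cos_eq ha' (arcsin_mem ha ha' hs), sin_arcsin_mem hs]
      · rw [iim k hk, h2, sin_arcsin_mem hs]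
    · rintro ⟨k, hk, φ, hφ, rfl⟩
      have hk' : k ≤ n := hk
      exact ⟨k, hk', sin φ, sin_mem ha' hφ, by rw [ire k hk', cos_eq ha' hφ], by rw [iim k hk']⟩
end

section
/- Let N ≥ 2 be an integer and suppose a ≤ (1/2)·arccos(−1/(N−1)). Then the principal argument is injective on C_in: for any z₁, z₂ ∈ C_in with arg z₁ = arg z₂ one has z₁ = z₂. -/
open Real

lemma aux_strict (a : ℝ) (ha : 0 < a) (ha' : a < π / 2) (n d : ℝ) (hn : 1 ≤ n)
    (hd : |d| ≤ n) (hc : 0 ≤ n * cos (2 * a) + 1) (p q : ℝ) (hp : -a ≤ p) (hpq : p < q)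
    (hq : q ≤ a) :
    (d * sin a + sin p) / (n * cos a + cos p) < (d * sin a + sin q) / (n * cos a + cos q) := by
  have hca : 0 < cos a := cos_pos_of_mem_Ioo ⟨by linarith, ha'⟩
  have hsa : 0 < sin a := sin_pos_of_pos_of_lt_pi ha (by linarith [pi_pos])
  have hcp : 0 < cos p := cos_pos_of_mem_Ioo ⟨by linarith, by linarith⟩
  have hcq : 0 < cos q := cos_pos_of_mem_Ioo ⟨by linarith, by linarith⟩
  have hnc : 0 < n * cos a := by positivity
  rw [div_lt_div_iff₀ (by linarith) (by linarith)]
  obtain ⟨u, hu⟩ : ∃ u, u = (p + q) / 2 := ⟨_, rfl⟩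
  obtain ⟨e, he⟩ : ∃ e, e = (q - p) / 2 := ⟨_, rfl⟩
  have h1 : p = u - e := by linarith
  have h2 : q = u + e := by linarith
  have he0 : 0 < e := by linarith
  have hut : |u| ≤ a - e := abs_le.2 ⟨by linarith, by linarith⟩
  have hse : 0 < sin e := sin_pos_of_pos_of_lt_pi he0 (by linarith [abs_nonneg u, pi_pos])
  have h0 := abs_nonneg u
  have hct : cos a < cos |u| := cos_lt_cos_of_nonneg_of_le_pi (by linarith) (by linarith) (by linarith)
  have hst : sin |u| < sin a := sin_lt_sin_of_lt_of_le_pi_div_two (by linarith) (by linarith) (by linarith)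
  have hst0 : 0 ≤ sin |u| := sin_nonneg_of_nonneg_of_le_pi h0 (by linarith)
  have hce : cos (a - |u|) ≤ cos e := cos_le_cos_of_nonneg_of_le_pi (by linarith) (by linarith) (by linarith)
  rw [cos_sub] at hce
  have hsu : |sin u| = sin |u| := by
    rcases abs_cases u with ⟨h, h'⟩ | ⟨h, h'⟩
    · rw [h] at hst0 ⊢; exact abs_of_nonneg hst0
    · rw [h] at hst0 ⊢
      rw [sin_neg] at hst0 ⊢
      exact abs_of_nonpos (by linarith)
  have hdu : -(n * sin |u|) ≤ d * sin u := by
    have := neg_abs_le (d * sin u)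
    rw [abs_mul, hsu] at this
    have := mul_le_mul_of_nonneg_right hd hst0
    linarith
  have hdu' : -(n * sin |u|) * sin a ≤ d * sin u * sin a := mul_le_mul_of_nonneg_right hdu hsa.le
  rw [cos_two_mul'] at hc
  have hpy := sin_sq_add_cos_sq a
  have key : 0 < (n + 1) * (cos a * cos |u|) - (n - 1) * (sin a * sin |u|) := by
    have i1 : cos a * cos a < cos a * cos |u| := mul_lt_mul_of_pos_left hct hca
    have i2 : sin a * sin |u| ≤ sin a * sin a := (mul_lt_mul_of_pos_left hst hsa).le
    have i3 : (n + 1) * (cos a * cos a) < (n + 1) * (cos a * cos |u|) :=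
      mul_lt_mul_of_pos_left i1 (by linarith)
    have i4 : (n - 1) * (sin a * sin |u|) ≤ (n - 1) * (sin a * sin a) :=
      mul_le_mul_of_nonneg_left i2 (by linarith)
    nlinarith
  have hb : 0 < cos e + n * cos a * cos u + d * sin a * sin u := by
    rw [← cos_abs u]; nlinarith
  have hfin := mul_pos hse hb
  rw [h1, h2, sin_sub, sin_add, cos_sub, cos_add]
  have hpe := sin_sq_add_cos_sq u
  have : sin e * cos e * (sin u ^2 + cos u ^ 2) = sin e * cos e := by rw [hpe, mul_one]
  nlinarith

lemma aux_le (a : ℝ) (ha : 0 < a) (ha' : a < π / 2) (n d : ℝ) (hn : 1 ≤ n)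
    (hd : |d| ≤ n) (hc : 0 ≤ n * cos (2 * a) + 1) (p q : ℝ) (hp : -a ≤ p) (hpq : p ≤ q)
    (hq : q ≤ a) :
    (d * sin a + sin p) / (n * cos a + cos p) ≤ (d * sin a + sin q) / (n * cos a + cos q) := by
  rcases hpq.eq_or_lt with rfl | h
  · exact le_rfl
  · exact (aux_strict a ha ha' n d hn hd hc p q hp h hq).le

/-- two arcs with k < l. -/
lemma aux_arcs (a : ℝ) (ha : 0 < a) (ha' : a < π / 2) (n k l : ℝ) (hn : 1 ≤ n)
    (hk : 0 ≤ k) (hkl : k + 1 ≤ l) (hl : l ≤ n) (hc : 0 ≤ n * cos (2 * a) + 1)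
    (p q : ℝ) (hp : -a ≤ p) (hp' : p ≤ a) (hq : -a ≤ q) (hq' : q ≤ a)
    (h : ((2 * k - n) * sin a + sin p) / (n * cos a + cos p)
      = ((2 * l - n) * sin a + sin q) / (n * cos a + cos q)) :
    l = k + 1 ∧ p = a ∧ q = -a := by
  have hca : 0 < cos a := cos_pos_of_mem_Ioo ⟨by linarith, ha'⟩
  have hsa : 0 < sin a := sin_pos_of_pos_of_lt_pi ha (by linarith [pi_pos])
  have hnc : 0 < n * cos a := by positivity
  have d1 : |2 * k - n| ≤ n := abs_le.2 ⟨by linarith, by linarith⟩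
  have d2 : |2 * l - n| ≤ n := abs_le.2 ⟨by linarith, by linarith⟩
  have a1 := aux_le a ha ha' n _ hn d1 hc p a hp hp' le_rfl
  have a2 := aux_le a ha ha' n _ hn d2 hc (-a) q le_rfl hq hq'
  rw [cos_neg, sin_neg] at a2
  have a3 : ((2 * k - n) * sin a + sin a) / (n * cos a + cos a)
      ≤ ((2 * l - n) * sin a + -sin a) / (n * cos a + cos a) := by
    apply div_le_div_of_nonneg_right _ (by linarith)
    nlinarith
  refine ⟨?_, ?_, ?_⟩
  · by_contra hne
    have hlt : k + 1 < l := lt_of_le_of_ne hkl (Ne.symm hne)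
    have : ((2 * k - n) * sin a + sin a) / (n * cos a + cos a)
      < ((2 * l - n) * sin a + -sin a) / (n * cos a + cos a) := by
      apply div_lt_div_of_pos_right _ (by linarith)
      nlinarith
    linarith
  · by_contra hne
    have := aux_strict a ha ha' n _ hn d1 hc p a hp (lt_of_le_of_ne hp' hne) le_rfl
    linarith
  · by_contra hne
    have := aux_strict a ha ha' n _ hn d2 hc (-a) q le_rfl (lt_of_le_of_ne hq (Ne.symm hne)) hq'
    rw [cos_neg, sin_neg] at this
    linarith

lemma Cin_coords (a : ℝ) (N : ℕ) (hN : 2 ≤ N) (z : ℂ) (hz : z ∈ Cin a N) :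
    ∃ k : ℕ, k ≤ N - 1 ∧ ∃ φ, -a ≤ φ ∧ φ ≤ a ∧
      z.re = ((N : ℝ) - 1) * cos a + cos φ ∧
      z.im = (2 * (k : ℝ) - ((N : ℝ) - 1)) * sin a + sin φ := by
  obtain ⟨k, hk, φ, ⟨h1, h2⟩, rfl⟩ := hz
  refine ⟨k, hk, φ, h1, h2, ?_, ?_⟩
  all_goals
    rw [Nat.cast_sub hk, Nat.cast_sub (by omega : 1 ≤ N), ← Complex.ofReal_neg]
    simp [Complex.exp_ofReal_mul_I_re, Complex.exp_ofReal_mul_I_im,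
      -Complex.ofReal_neg]
    ring

lemma aux_half (z w : ℂ) (s t : ℝ) (hs : s = 1 ∨ s = -1) (ht : t = 1 ∨ t = -1)
    (hz0 : 0 ≤ z.re) (hw0 : 0 ≤ w.re)
    (hz : z.re ^ 2 + z.im ^ 2 = 2 * s * z.im) (hw : w.re ^ 2 + w.im ^ 2 = 2 * t * w.im)
    (h : z.arg = w.arg) : z = w := by
  have zero : ∀ (z : ℂ) (s : ℝ), z.re ^ 2 + z.im ^ 2 = 2 * s * z.im → z.arg = 0 → z = 0 := by
    intro z s hz h
    have := (Complex.arg_eq_zero_iff.1 h).2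
    rw [this] at hz
    apply Complex.ext
    · simp; nlinarith
    · simpa using this
  by_cases hz' : z = 0
  · subst hz'
    rw [zero w t hw (by rw [← h]; simp)]
  by_cases hw' : w = 0
  · subst hw'
    exact zero z s hz (by rw [h]; simp)
  have hr := (Complex.arg_eq_arg_iff hz' hw').1 h
  have hpos : 0 < ‖w‖ / ‖z‖ := div_pos (norm_pos_iff.2 hw') (norm_pos_iff.2 hz')
  rw [← Complex.ofReal_div] at hr
  generalize ‖w‖ / ‖z‖ = r at hr hpos
  have e1 : w.re = r * z.re := by rw [← hr]; simp
  have e2 : w.im = r * z.im := by rw [← hr]; simp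
  have hzn : 0 < z.re ^ 2 + z.im ^ 2 := by
    have := Complex.normSq_pos.2 hz'
    rw [Complex.normSq_apply] at this; nlinarith
  rw [e1, e2] at hw
  have hw2 : r * (z.re ^ 2 + z.im ^ 2) = 2 * t * z.im := by
    apply mul_left_cancel₀ hpos.ne'
    linarith
  have hr1 : r = 1 := by
    have hst : s = t := by
      have := mul_pos hpos hzn
      rcases hs with rfl | rfl <;> rcases ht with rfl | rfl <;> first | rfl | (exfalso; linarith)
    subst hst
    have : r * (z.re ^ 2 + z.im ^ 2) = 1 * (z.re ^ 2 + z.im ^ 2) := by linarith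
    exact mul_right_cancel₀ hzn.ne' this
  rw [← hr, hr1]; simp

theorem stmt13 (a : ℝ) (ha : 0 < a) (ha' : a ≤ π / 2) (N : ℕ) (hN : 2 ≤ N)
    (hcond : a ≤ (1 / 2) * Real.arccos (-1 / ((N : ℝ) - 1))) :
    ∀ z₁ ∈ Cin a N, ∀ z₂ ∈ Cin a N, Complex.arg z₁ = Complex.arg z₂ → z₁ = z₂ := by
  intro z hz w hw harg
  have hN' : (2 : ℝ) ≤ N := by exact_mod_cast hN
  have hn : (1 : ℝ) ≤ (N : ℝ) - 1 := by linarith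
  have hc : 0 ≤ ((N : ℝ) - 1) * cos (2 * a) + 1 := by
    have h1 : -1 / ((N : ℝ) - 1) ≤ cos (2 * a) := by
      have h2 : cos (arccos (-1 / ((N : ℝ) - 1))) ≤ cos (2 * a) :=
        cos_le_cos_of_nonneg_of_le_pi (by linarith) (arccos_le_pi _) (by linarith)
      rwa [cos_arccos] at h2
      · rw [le_div_iff₀ (by linarith)]; linarith
      · rw [div_le_iff₀ (by linarith)]; linarith
    rw [div_le_iff₀ (by linarith)] at h1
    linarith
  obtain ⟨k, hk, p, hp, hp', zr, zi⟩ := Cin_coords a N hN z hz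
  obtain ⟨l, hl, q, hq, hq', wr, wi⟩ := Cin_coords a N hN w hw
  rcases ha'.eq_or_lt with rfl | hlt
  · have : 2 * (π / 2) = π := by ring
    rw [this, cos_pi] at hc
    have hN2 : N = 2 := by
      have : (N : ℝ) ≤ 2 := by linarith
      have : N ≤ 2 := by exact_mod_cast this
      omega
    subst hN2
    simp only [cos_pi_div_two, sin_pi_div_two] at zr zi wr wi
    norm_num at zr zi wr wi
    have c1 : 0 ≤ cos p := cos_nonneg_of_mem_Icc ⟨hp, hp'⟩
    have c2 : 0 ≤ cos q := cos_nonneg_of_mem_Icc ⟨hq, hq'⟩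
    have s : ∀ k : ℕ, k ≤ 2 - 1 → (2 * (k : ℝ) - 1 = 1 ∨ 2 * (k : ℝ) - 1 = -1) := by
      intro k hk
      interval_cases k <;> norm_num
    have sq : ∀ k : ℝ, (k = 1 ∨ k = -1) → k ^ 2 = 1 := by
      rintro k (rfl | rfl) <;> norm_num
    apply aux_half z w _ _ (s k hk) (s l hl) (by linarith) (by linarith) _ _ harg
    · rw [zr, zi]; linarith [sin_sq_add_cos_sq p, sq _ (s k hk)]
    · rw [wr, wi]; linarith [sin_sq_add_cos_sq q, sq _ (s l hl)]
  · have ht : z.im / z.re = w.im / w.re := by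
      rw [← Complex.tan_arg, ← Complex.tan_arg, harg]
    rw [zr, zi, wr, wi] at ht
    have bd : ∀ k : ℕ, k ≤ N - 1 → (k : ℝ) ≤ (N : ℝ) - 1 := by
      intro k hk
      have : k + 1 ≤ N := by omega
      have : (k : ℝ) + 1 ≤ N := by exact_mod_cast this
      linarith
    have bk := bd k hk
    have bl := bd l hl
    have k0 : (0 : ℝ) ≤ k := k.cast_nonneg
    have l0 : (0 : ℝ) ≤ l := l.cast_nonneg
    rcases lt_trichotomy k l with h | h | h
    · have h' : (k : ℝ) + 1 ≤ l := by exact_mod_cast h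
      obtain ⟨e1, e2, e3⟩ := aux_arcs a ha hlt _ k l hn k0 h' bl hc p q hp hp' hq hq' ht
      apply Complex.ext
      · rw [zr, wr, e2, e3, cos_neg]
      · rw [zi, wi, e1, e2, e3, sin_neg]; ring
    · subst h
      have hd : |2 * (k : ℝ) - ((N : ℝ) - 1)| ≤ (N : ℝ) - 1 :=
        abs_le.2 ⟨by linarith, by linarith⟩
      rcases lt_trichotomy p q with h | h | h
      · have := aux_strict a ha hlt _ _ hn hd hc p q hp h hq'
        linarith
      · subst h
        exact Complex.ext (by rw [zr, wr]) (by rw [zi, wi])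
      · have := aux_strict a ha hlt _ _ hn hd hc q p hq h hp'
        linarith
    · have h' : (l : ℝ) + 1 ≤ k := by exact_mod_cast h
      obtain ⟨e1, e2, e3⟩ := aux_arcs a ha hlt _ l k hn l0 h' bk hc q p hq hq' hp hp' ht.symm
      apply Complex.ext
      · rw [zr, wr, e2, e3, cos_neg]
      · rw [zi, wi, e1, e2, e3, sin_neg]; ring
end

section
/- Let m ∈ ℝ and s₁, s₂ > 0, and let X and Y be independent real random variables with X Gaussian of mean m and variance s₁² and Y Gaussian of mean 0 and variance s₂². Then the law of the pair (√(X² + Y²), arg(X + iY)) ∈ ℝ² is absolutely continuous with respect to two-dimensional Lebesgue measure, with joint density g(r, θ) = (r/(2π·s₁·s₂)) · exp(−(r·cos θ − m)²/(2s₁²)) · exp(−(r·sin θ)²/(2s₂²)) for r > 0 and −π < θ ≤ π, and g(r, θ) = 0 otherwise. -/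
open MeasureTheory Real ProbabilityTheory

/-- The joint density of radius and angle of a pair of independent Gaussians. -/
noncomputable def polarDensity (m s₁ s₂ : ℝ) (p : ℝ × ℝ) : ℝ :=
  if 0 < p.1 ∧ -π < p.2 ∧ p.2 ≤ π then
    (p.1 / (2 * π * s₁ * s₂)) * Real.exp (-(p.1 * Real.cos p.2 - m) ^ 2 / (2 * s₁ ^ 2))
      * Real.exp (-(p.1 * Real.sin p.2) ^ 2 / (2 * s₂ ^ 2))
  else 0

theorem stmt19 {Ω : Type*} [MeasurableSpace Ω] (P : Measure Ω) [IsProbabilityMeasure P]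
    (m s₁ s₂ : ℝ) (hs₁ : 0 < s₁) (hs₂ : 0 < s₂)
    (X Y : Ω → ℝ) (hX : Measurable X) (hY : Measurable Y)
    (hindep : IndepFun X Y P)
    (hlawX : Measure.map X P = gaussianReal m (s₁ ^ 2).toNNReal)
    (hlawY : Measure.map Y P = gaussianReal 0 (s₂ ^ 2).toNNReal) :
    (Measure.map
        (fun ω => (Real.sqrt (X ω ^ 2 + Y ω ^ 2),
          Complex.arg ((X ω : ℂ) + (Y ω : ℂ) * Complex.I))) P)
      ≪ (volume : Measure (ℝ × ℝ)) ∧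
    (Measure.map
        (fun ω => (Real.sqrt (X ω ^ 2 + Y ω ^ 2),
          Complex.arg ((X ω : ℂ) + (Y ω : ℂ) * Complex.I))) P)
      = (volume : Measure (ℝ × ℝ)).withDensity
          (fun p => ENNReal.ofReal (polarDensity m s₁ s₂ p)) := by
  have hv : ∀ s : ℝ, 0 < s → (s ^ 2).toNNReal ≠ 0 := by
    intro s hs h
    rw [Real.toNNReal_eq_zero] at h
    exact absurd h (not_le.mpr (by positivity))
  suffices key : (Measure.map
        (fun ω => (Real.sqrt (X ω ^ 2 + Y ω ^ 2),
          Complex.arg ((X ω : ℂ) + (Y ω : ℂ) * Complex.I))) P)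
      = (volume : Measure (ℝ × ℝ)).withDensity
          (fun p => ENNReal.ofReal (polarDensity m s₁ s₂ p)) by
    refine ⟨?_, key⟩
    rw [key]
    exact withDensity_absolutelyContinuous _ _
  set T : ℝ × ℝ → ℝ × ℝ := fun q => (Real.sqrt (q.1 ^ 2 + q.2 ^ 2),
    Complex.arg ((q.1 : ℂ) + (q.2 : ℂ) * Complex.I)) with hT
  have hTm : Measurable T := by
    refine Measurable.prodMk (by fun_prop) (Complex.measurable_arg.comp ?_)
    exact ((Complex.measurable_ofReal.comp measurable_fst).add
      ((Complex.measurable_ofReal.comp measurable_snd).mul_const _))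
  have hTp : ∀ q, T q = polarCoord q := by
    intro q
    rw [polarCoord_apply]
    simp [hT, Complex.equivRealProd_symm_apply]
  have hcomp : (fun ω => (Real.sqrt (X ω ^ 2 + Y ω ^ 2),
      Complex.arg ((X ω : ℂ) + (Y ω : ℂ) * Complex.I))) = T ∘ (fun ω => (X ω, Y ω)) := rfl
  rw [hcomp, ← Measure.map_map hTm (hX.prodMk hY),
    (indepFun_iff_map_prod_eq_prod_map_map hX.aemeasurable hY.aemeasurable).1 hindep,
    hlawX, hlawY, gaussianReal_of_var_ne_zero _ (hv s₁ hs₁),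
    gaussianReal_of_var_ne_zero _ (hv s₂ hs₂),
    prod_withDensity (measurable_gaussianPDF _ _) (measurable_gaussianPDF _ _)]
  have hae : (polarCoord.target : Set (ℝ × ℝ)) =ᵐ[volume]
      (Set.Ioi (0 : ℝ) ×ˢ Set.Ioc (-π) π : Set (ℝ × ℝ)) := by
    rw [polarCoord_target, Measure.volume_eq_prod]
    exact Measure.set_prod_ae_eq (Filter.EventuallyEq.refl _ _) Ioo_ae_eq_Ioc
  have hTmeas : MeasurableSet (Set.Ioi (0 : ℝ) ×ˢ Set.Ioc (-π) π : Set (ℝ × ℝ)) :=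
    measurableSet_Ioi.prod measurableSet_Ioc
  have hpt := polarCoord.open_target.measurableSet
  ext A hA
  rw [Measure.map_apply hTm hA, withDensity_apply _ (hTm hA), withDensity_apply _ hA,
    ← lintegral_indicator (hTm hA), ← Measure.volume_eq_prod, ← lintegral_comp_polarCoord_symm,
    ← lintegral_indicator hA]
  have h1 : ∫⁻ p, A.indicator (fun p => ENNReal.ofReal (polarDensity m s₁ s₂ p)) p
      = ∫⁻ p in polarCoord.target,
        A.indicator (fun p => ENNReal.ofReal (polarDensity m s₁ s₂ p)) p := by
    rw [setLIntegral_congr hae, ← lintegral_indicator hTmeas]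
    congr 1
    ext p
    by_cases hp : p ∈ (Set.Ioi (0 : ℝ) ×ˢ Set.Ioc (-π) π : Set (ℝ × ℝ))
    · rw [Set.indicator_of_mem hp]
    · rw [Set.indicator_of_notMem hp]
      have : polarDensity m s₁ s₂ p = 0 := by
        unfold polarDensity
        exact if_neg (fun h => hp ⟨h.1, h.2⟩)
      by_cases hpA : p ∈ A <;> simp [hpA, this]
  rw [h1]
  refine setLIntegral_congr_fun hpt (fun p hp => ?_)
  have hTs : T (polarCoord.symm p) = p := by
    rw [hTp]; exact polarCoord.right_inv hp
  have hp' := hp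
  rw [polarCoord_target] at hp'
  have hr : 0 < p.1 := hp'.1
  by_cases hpA : p ∈ A
  · have hmem : polarCoord.symm p ∈ T ⁻¹' A := by
      rw [Set.mem_preimage, hTs]; exact hpA
    simp only [Set.indicator_of_mem hmem, Set.indicator_of_mem hpA, smul_eq_mul]
    rw [gaussianPDF, gaussianPDF, ← ENNReal.ofReal_mul (gaussianPDFReal_nonneg _ _ _),
      ← ENNReal.ofReal_mul hr.le]
    congr 1
    unfold polarDensity
    rw [if_pos ⟨hr, hp'.2.1, hp'.2.2.le⟩]
    simp only [polarCoord_symm_apply, gaussianPDFReal, Real.coe_toNNReal _ (sq_nonneg _), sub_zero]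
    rw [Real.sqrt_mul (by positivity), Real.sqrt_mul (by positivity) (s₂ ^ 2),
      Real.sqrt_sq hs₁.le, Real.sqrt_sq hs₂.le]
    have h2 : (2 * π * s₁ * s₂) = (√(2 * π) * s₁) * (√(2 * π) * s₂) := by
      have := Real.mul_self_sqrt (show (0:ℝ) ≤ 2 * π by positivity)
      linear_combination (-(s₁ * s₂)) * this
    rw [h2, div_eq_mul_inv, mul_inv]
    ring
  · have hmem : polarCoord.symm p ∉ T ⁻¹' A := by
      rw [Set.mem_preimage, hTs]; exact hpA
    simp only [Set.indicator_of_notMem hmem, Set.indicator_of_notMem hpA, smul_zero]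
end
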